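/- Let X be a complete metric space and P a porosity-like relation on X. Let A be a Suslin scheme consisting of closed subsets of X and let C ⊆ S(A) be a Suslin set with ker_P(C) = C ≠ ∅. Then there exists a P-regular Suslin scheme L = {L(s) : s ∈ ω^{<ω}} consisting of closed subsets of X such that L is subordinate to A and S(L) is a dense subset of C. -/

import Mathlib

open Set Metric Filter Topology

/-- `P` is a porosity-like relation on the metric space `X`. -/
def IsPorosityLike (X : Type*) [MetricSpace X] (P : X → Set X → Prop) : Prop :=
  (∀ (x : X) (A B : Set X), A ⊆ B → P x B → P x A) ∧
  (∀ (x : X) (A : Set X), P x A ↔ ∃ r > 0, P x (A ∩ Metric.ball x r)) ∧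
  (∀ (x : X) (A : Set X), P x A ↔ P x (closure A))

/-- A set is `P`-porous if `P x A` holds at every point `x ∈ A`. -/
def PPorous {X : Type*} [MetricSpace X] (P : X → Set X → Prop) (A : Set X) : Prop :=
  ∀ x ∈ A, P x A

/-- A set is σ-`P`-porous if it is a countable union of `P`-porous sets. -/
def SigmaPPorous {X : Type*} [MetricSpace X] (P : X → Set X → Prop) (A : Set X) : Prop :=
  ∃ f : ℕ → Set X, (∀ n, PPorous P (f n)) ∧ A = ⋃ n, f n

/-- `ker_P(A) = A \ ⋃ {U : U open and U ∩ A is σ-P-porous}`. -/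
def kerP {X : Type*} [MetricSpace X] (P : X → Set X → Prop) (A : Set X) : Set X :=
  A \ ⋃₀ {U : Set X | IsOpen U ∧ SigmaPPorous P (U ∩ A)}

/-- `N_P(A) = {x ∈ A : ¬ P(x,A)}`. -/
def NP {X : Type*} [MetricSpace X] (P : X → Set X → Prop) (A : Set X) : Set X :=
  {x ∈ A | ¬ P x A}

/-- The initial segment `ν|n` of an infinite sequence `ν`, as a finite sequence. -/
def seg (ν : ℕ → ℕ) (n : ℕ) : List ℕ := (List.range n).map ν

/-- The Suslin operation applied to a Suslin scheme indexed by finite sequences. -/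
def SuslinOp {X : Type*} (A : List ℕ → Set X) : Set X :=
  ⋃ ν : ℕ → ℕ, ⋂ n : ℕ, A (seg ν n)

/-- A set is Suslin if it is the result of the Suslin operation applied to a scheme
of closed sets. -/
def IsSuslin {X : Type*} [TopologicalSpace X] (S : Set X) : Prop :=
  ∃ A : List ℕ → Set X, (∀ s, IsClosed (A s)) ∧ SuslinOp A = S

/-- `S` is a `(B,P)`-Foran scheme in `X`. -/
def IsForanScheme {X : Type*} [MetricSpace X] (B : Set (Set X)) (P : X → Set X → Prop)
    (S : List ℕ → Set X) : Prop :=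
  (∀ t, (S t).Nonempty) ∧
  (∀ t : List ℕ, (⋃ j : ℕ, S (t ++ [j])) ⊆ S t ∧ S t ⊆ closure (⋃ j : ℕ, S (t ++ [j]))) ∧
  (∀ (t : List ℕ) (k : ℕ), ∀ x ∈ S (t ++ [k]), ¬ P x (S t)) ∧
  (∀ (ν : ℕ → ℕ) (G : ℕ → Set X), (∀ n, G n ∈ B) →
    Filter.Tendsto (fun n => EMetric.diam (G n)) Filter.atTop (nhds 0) →
    (∀ n, closure (G (n + 1)) ⊆ G n) →
    (∀ n, (S (seg ν n) ∩ G n).Nonempty) →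
    (⋂ n, S (seg ν n) ∩ G n).Nonempty)

/-- A Suslin scheme `C` is subordinate to a Suslin scheme `A`. -/
def Subordinate {X : Type*} (C A : List ℕ → Set X) : Prop :=
  ∃ φ : List ℕ → List ℕ,
    (∀ s, (φ s).length = s.length) ∧
    (∀ s t : List ℕ, s <+: t → φ s <+: φ t) ∧
    (∀ s, C s ⊆ A (φ s))

/-- A Suslin scheme `A` is `P`-regular: it is monotone and, with
`C(s) = 𝒮_t(A(s ⌢ t))`, one has `ker_P(C(s)) = C(s) ≠ ∅` for every `s`. -/
def PRegular {X : Type*} [MetricSpace X] (P : X → Set X → Prop)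
    (A : List ℕ → Set X) : Prop :=
  (∀ s t : List ℕ, s <+: t → A t ⊆ A s) ∧
  (∀ s : List ℕ,
    kerP P (SuslinOp fun t => A (s ++ t)) = (SuslinOp fun t => A (s ++ t)) ∧
    (SuslinOp fun t => A (s ++ t)).Nonempty)


section Helpers

theorem seg_succ' (ν : ℕ → ℕ) (n : ℕ) : seg ν (n + 1) = seg ν n ++ [ν n] := by
  simp [seg, List.range_succ]

theorem seg_len (ν : ℕ → ℕ) (n : ℕ) : (seg ν n).length = n := by
  simp [seg]

theorem seg_add' (ν : ℕ → ℕ) (m n : ℕ) :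
    seg ν (m + n) = seg ν m ++ seg (fun k => ν (m + k)) n := by
  induction n with
  | zero => simp [seg]
  | succ n ih => rw [← add_assoc, seg_succ', ih, seg_succ', List.append_assoc]

theorem seg_prefix (ν : ℕ → ℕ) {m n : ℕ} (h : m ≤ n) : seg ν m <+: seg ν n := by
  obtain ⟨k, rfl⟩ := Nat.exists_eq_add_of_le h
  rw [seg_add']
  exact List.prefix_append _ _

theorem seg_map (f : ℕ → ℕ) (ν : ℕ → ℕ) (n : ℕ) : (seg ν n).map f = seg (fun k => f (ν k)) n := by
  simp [seg]

/-- points given by branches through `s` -/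
def Br {X : Type*} (D : List ℕ → Set X) (s : List ℕ) : Set X :=
  {x | ∃ ν : ℕ → ℕ, seg ν s.length = s ∧ ∀ n, x ∈ D (seg ν n)}

theorem Br_mono {X : Type*} (D : List ℕ → Set X) {s t : List ℕ} (h : s <+: t) :
    Br D t ⊆ Br D s := by
  rintro x ⟨ν, h1, h2⟩
  refine ⟨ν, ?_, h2⟩
  have h3 : seg ν s.length <+: t := by
    rw [← h1]; exact (seg_prefix ν h.length_le).trans (by rw [h1])
  have h4 : seg ν s.length <+: s :=
    List.prefix_of_prefix_length_le h3 h (by rw [seg_len])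
  exact h4.eq_of_length (seg_len _ _)

theorem Br_sub {X : Type*} (D : List ℕ → Set X) (s : List ℕ) : Br D s ⊆ D s := by
  rintro x ⟨ν, h1, h2⟩
  have := h2 s.length
  rwa [h1] at this

theorem Br_child {X : Type*} (D : List ℕ → Set X) (s : List ℕ) :
    Br D s ⊆ ⋃ n, Br D (s ++ [n]) := by
  rintro x ⟨ν, h1, h2⟩
  refine mem_iUnion.2 ⟨ν s.length, ν, ?_, h2⟩
  rw [List.length_append, List.length_singleton, seg_succ', h1]

theorem suslin_eq_Br {X : Type*} (L : List ℕ → Set X)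
    (hL : ∀ s t : List ℕ, s <+: t → L t ⊆ L s) (s : List ℕ) :
    SuslinOp (fun t => L (s ++ t)) = Br L s := by
  ext x
  simp only [SuslinOp, mem_iUnion, mem_iInter]
  constructor
  · rintro ⟨μ, hμ⟩
    let ν : ℕ → ℕ := fun n => if h : n < s.length then s[n] else μ (n - s.length)
    have h1 : seg ν s.length = s := by
      apply List.ext_getElem (seg_len _ _)
      intro n h2 h3
      simp [seg, ν, h3]
    have h2 : ∀ n, seg ν (s.length + n) = s ++ seg μ n := by
      intro n
      rw [seg_add', h1]
      congr 2
      ext k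
      simp [ν]
    refine ⟨ν, h1, fun n => ?_⟩
    apply hL _ _ (seg_prefix ν (Nat.le_add_left n s.length))
    rw [h2]; exact hμ n
  · rintro ⟨ν, h1, h2⟩
    refine ⟨fun k => ν (s.length + k), fun n => ?_⟩
    have := h2 (s.length + n)
    rwa [seg_add', h1] at this

variable {X : Type*} [MetricSpace X] {P : X → Set X → Prop}

theorem porous_mono (hP : IsPorosityLike X P) {A B : Set X} (h : A ⊆ B) (hB : PPorous P B) :
    PPorous P A := fun x hx => hP.1 x A B h (hB x (h hx))

theorem sigma_mono (hP : IsPorosityLike X P) {A B : Set X} (h : A ⊆ B) (hB : SigmaPPorous P B) :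
    SigmaPPorous P A := by
  obtain ⟨f, hf, rfl⟩ := hB
  refine ⟨fun n => A ∩ f n, fun n => porous_mono hP inter_subset_right (hf n), ?_⟩
  rw [← inter_iUnion, inter_eq_left.2 h]

theorem sigma_of_countable {ι : Type*} [Countable ι] (f : ι → Set X)
    (hf : ∀ i, PPorous P (f i)) : SigmaPPorous P (⋃ i, f i) := by
  rcases isEmpty_or_nonempty ι with h | h
  · exact ⟨fun _ => ∅, fun _ x hx => hx.elim, by simp⟩
  · obtain ⟨g, hg⟩ := exists_surjective_nat ι
    exact ⟨fun n => f (g n), fun n => hf _, (hg.iUnion_comp f).symm⟩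

theorem sigma_iUnion {ι : Type*} [Countable ι] (f : ι → Set X)
    (hf : ∀ i, SigmaPPorous P (f i)) : SigmaPPorous P (⋃ i, f i) := by
  choose g hg he using hf
  have : (⋃ i, f i) = ⋃ p : ι × ℕ, g p.1 p.2 := by
    rw [iUnion_prod']
    exact iUnion_congr he
  rw [this]
  exact sigma_of_countable _ fun p => hg _ _

theorem sigma_union {A B : Set X} (hA : SigmaPPorous P A) (hB : SigmaPPorous P B) :
    SigmaPPorous P (A ∪ B) := by
  rw [union_eq_iUnion]
  exact sigma_iUnion _ (by rintro (_ | _) <;> assumption)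

theorem sigma_diff_ker (hP : IsPorosityLike X P) (A : Set X) : SigmaPPorous P (A \ kerP P A) := by
  let ι := {U : Set X | IsOpen U ∧ SigmaPPorous P (U ∩ A)}
  have hs : ∀ i : ι, ∃ f : ℕ → Set X, (∀ n, PPorous P (f n)) ∧ i.1 ∩ A = ⋃ n, f n :=
    fun i => i.2.2
  choose f hf he using hs
  let r : ι → ι → Prop := WellOrderingRel
  let S : ι → ℕ → Set X := fun i n =>
    {x | ball x (1 / ((n : ℝ) + 1)) ⊆ i.1 ∧ ∀ j, r j i → x ∉ j.1}
  have key : ∀ p : ℕ × ℕ, PPorous P (⋃ i, S i p.1 ∩ f i p.2) := by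
    rintro ⟨n, m⟩ x hx
    obtain ⟨i, hxi, hxf⟩ := mem_iUnion.1 hx
    have hpos : (0 : ℝ) < 1 / ((n : ℝ) + 1) := by positivity
    refine (hP.2.1 x _).2 ⟨_, hpos, hP.1 x _ (f i m) ?_ (hf i m x hxf)⟩
    rintro y ⟨hy, hyx⟩
    obtain ⟨j, hyj, hyf⟩ := mem_iUnion.1 hy
    rcases trichotomous_of r i j with h | h | h
    · exact absurd (hxi.1 hyx) (hyj.2 i h)
    · subst h; exact hyf
    · exact absurd (hyj.1 (mem_ball_comm.1 hyx)) (hxi.2 j h)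
  refine sigma_mono hP ?_ (sigma_of_countable _ key)
  rintro x ⟨hxA, hxk⟩
  have hex : ∃ i : ι, x ∈ i.1 := by
    by_contra hcon
    apply hxk
    refine ⟨hxA, ?_⟩
    rintro ⟨U, hU, hxU⟩
    exact hcon ⟨⟨U, hU⟩, hxU⟩
  have hwf : WellFounded r := WellOrderingRel.isWellOrder.wf
  let i := hwf.min {i : ι | x ∈ i.1} hex
  have hi : x ∈ i.1 := hwf.min_mem {i : ι | x ∈ i.1} hex
  have hmin : ∀ j, r j i → x ∉ j.1 := fun j hj hx => hwf.not_lt_min {i : ι | x ∈ i.1} hx hj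
  obtain ⟨ε, hε, hball⟩ := Metric.isOpen_iff.1 i.2.1 x hi
  obtain ⟨n, hn⟩ := exists_nat_one_div_lt hε
  have hxf : x ∈ ⋃ m, f i m := by rw [← he]; exact ⟨hi, hxA⟩
  obtain ⟨m, hm⟩ := mem_iUnion.1 hxf
  exact mem_iUnion.2 ⟨(n, m), mem_iUnion.2 ⟨i, ⟨(ball_subset_ball hn.le).trans hball, hmin⟩, hm⟩⟩

theorem ker_sub (A : Set X) : kerP P A ⊆ A := diff_subset

theorem ker_mono (hP : IsPorosityLike X P) {A B : Set X} (h : A ⊆ B) : kerP P A ⊆ kerP P B := by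
  rintro x ⟨hx, hn⟩
  refine ⟨h hx, ?_⟩
  rintro ⟨U, ⟨hU, hs⟩, hxU⟩
  exact hn ⟨U, ⟨hU, sigma_mono hP (inter_subset_inter_right _ h) hs⟩, hxU⟩

theorem ker_not {A U : Set X} (hU : IsOpen U) (hs : SigmaPPorous P (U ∩ A)) {x : X}
    (hx : x ∈ kerP P A) : x ∉ U := fun hxU => hx.2 ⟨U, ⟨hU, hs⟩, hxU⟩

end Helpers

section Reg

variable {X : Type*} [MetricSpace X] (P : X → Set X → Prop)

/-- closure of the kernel of the branch set -/
def LL (D : List ℕ → Set X) (s : List ℕ) : Set X := closure (kerP P (Br D s))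

variable {P}

theorem LL_mono (hP : IsPorosityLike X P) (D : List ℕ → Set X) (s t : List ℕ) (h : s <+: t) :
    LL P D t ⊆ LL P D s := closure_mono (ker_mono hP (Br_mono D h))

theorem LL_sub (D : List ℕ → Set X) (hD : ∀ s, IsClosed (D s)) (s : List ℕ) :
    LL P D s ⊆ D s := closure_minimal ((ker_sub _).trans (Br_sub D s)) (hD s)

theorem BrL_sub (D : List ℕ → Set X) (hD : ∀ s, IsClosed (D s)) (s : List ℕ) :
    Br (LL P D) s ⊆ Br D s := by
  rintro x ⟨ν, h1, h2⟩
  exact ⟨ν, h1, fun n => LL_sub D hD _ (h2 n)⟩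

theorem diff_sigma (hP : IsPorosityLike X P) (D : List ℕ → Set X) (s : List ℕ) :
    SigmaPPorous P (Br D s \ Br (LL P D) s) := by
  refine sigma_mono hP ?_ (sigma_iUnion (fun t : List ℕ => Br D t \ kerP P (Br D t))
    fun t => sigma_diff_ker hP _)
  rintro x ⟨⟨ν, h1, h2⟩, hx⟩
  by_contra hcon
  apply hx
  refine ⟨ν, h1, fun n => ?_⟩
  by_contra hn
  exact hcon (mem_iUnion.2 ⟨seg ν n, ⟨ν, by rw [seg_len], h2⟩, fun h => hn (subset_closure h)⟩)

theorem big_sigma (hP : IsPorosityLike X P) (D : List ℕ → Set X) (s : List ℕ) (U : Set X)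
    (h : SigmaPPorous P (U ∩ Br (LL P D) s)) : SigmaPPorous P (U ∩ Br D s) := by
  refine sigma_mono hP ?_ (sigma_union h (diff_sigma hP D s))
  rintro x ⟨hU, hx⟩
  by_cases hxL : x ∈ Br (LL P D) s
  · exact Or.inl ⟨hU, hxL⟩
  · exact Or.inr ⟨hx, hxL⟩

theorem sigma_empty : SigmaPPorous P (∅ : Set X) := ⟨fun _ => ∅, fun _ x hx => hx.elim, by simp⟩

theorem ker_BrL (hP : IsPorosityLike X P) (D : List ℕ → Set X) (s : List ℕ) :
    kerP P (Br (LL P D) s) = Br (LL P D) s := by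
  refine (ker_sub _).antisymm fun x hx => ⟨hx, ?_⟩
  rintro ⟨U, ⟨hU, hs⟩, hxU⟩
  obtain ⟨y, hyU, hy⟩ := _root_.mem_closure_iff.1 (Br_sub _ _ hx) U hU hxU
  exact ker_not hU (big_sigma hP D s U hs) hy hyU

theorem ker_dense (hP : IsPorosityLike X P) (D : List ℕ → Set X) (s : List ℕ) :
    kerP P (Br D s) ⊆ closure (Br (LL P D) s) := by
  intro x hx
  rw [_root_.mem_closure_iff]
  intro U hU hxU
  by_contra hcon
  rw [not_nonempty_iff_eq_empty] at hcon
  exact ker_not hU (big_sigma hP D s U (hcon ▸ sigma_empty)) hx hxU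

theorem child_ne (hP : IsPorosityLike X P) (D : List ℕ → Set X) (s : List ℕ)
    (h : (kerP P (Br D s)).Nonempty) : ∃ n, (kerP P (Br D (s ++ [n]))).Nonempty := by
  by_contra! hcon
  obtain ⟨x, hx⟩ := h
  refine ker_not isOpen_univ ?_ hx (mem_univ x)
  rw [univ_inter]
  refine sigma_mono hP (Br_child D s) (sigma_iUnion _ fun n => ?_)
  have := sigma_diff_ker hP (Br D (s ++ [n]))
  rwa [hcon n, diff_empty] at this

end Reg

/-- reindexing of the tree -/
def psi (e : List ℕ → ℕ → ℕ) (s : List ℕ) : List ℕ := s.foldl (fun a n => a ++ [e a n]) []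

theorem psi_snoc (e : List ℕ → ℕ → ℕ) (s : List ℕ) (n : ℕ) :
    psi e (s ++ [n]) = psi e s ++ [e (psi e s) n] := by
  simp [psi]

theorem psi_prefix (e : List ℕ → ℕ → ℕ) (s t : List ℕ) (h : s <+: t) : psi e s <+: psi e t := by
  obtain ⟨u, rfl⟩ := h
  induction u using List.reverseRecOn with
  | nil => simp
  | append_singleton u n ih =>
    rw [← List.append_assoc, psi_snoc]
    exact ih.trans (List.prefix_append _ _)

theorem psi_length (e : List ℕ → ℕ → ℕ) (s : List ℕ) : (psi e s).length = s.length := by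
  induction s using List.reverseRecOn with
  | nil => rfl
  | append_singleton u n ih => rw [psi_snoc]; simp [ih]

theorem psi_suslin {X : Type*} (L : List ℕ → Set X) (T : List ℕ → Prop)
    (hT : ∀ s, (L s).Nonempty → T s) (e : List ℕ → ℕ → ℕ)
    (he : ∀ s n, T (s ++ [n]) → e s n = n) (s : List ℕ) :
    SuslinOp (fun t => L (psi e (s ++ t))) = SuslinOp (fun t => L (psi e s ++ t)) := by
  ext x
  simp only [SuslinOp, mem_iUnion, mem_iInter]
  constructor
  · rintro ⟨μ, hμ⟩
    refine ⟨fun k => e (psi e (s ++ seg μ k)) (μ k), fun n => ?_⟩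
    have : psi e s ++ seg (fun k => e (psi e (s ++ seg μ k)) (μ k)) n = psi e (s ++ seg μ n) := by
      induction n with
      | zero => simp [seg]
      | succ n ih => rw [seg_succ', seg_succ', ← List.append_assoc, ih, ← List.append_assoc, psi_snoc]
    rw [this]; exact hμ n
  · rintro ⟨ν, hν⟩
    refine ⟨ν, fun n => ?_⟩
    have : psi e (s ++ seg ν n) = psi e s ++ seg ν n := by
      induction n with
      | zero => simp [seg]
      | succ n ih =>
        have h := hT _ ⟨x, hν (n + 1)⟩
        rw [seg_succ', ← List.append_assoc] at h
        rw [seg_succ', ← List.append_assoc, psi_snoc, ih, he _ _ h, List.append_assoc]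
    rw [this]; exact hν n

/-- Given a Suslin scheme `A` of closed sets in a complete metric space and a nonempty
Suslin set `C ⊆ S(A)` with `ker_P(C) = C`, there exists a `P`-regular Suslin scheme `L`
of closed sets, subordinate to `A`, such that `S(L)` is a dense subset of `C`. -/
theorem exists_Pregular_subordinate_scheme
    {X : Type*} [MetricSpace X] [CompleteSpace X]
    (P : X → Set X → Prop) (hP : IsPorosityLike X P)
    (A : List ℕ → Set X) (hA : ∀ s, IsClosed (A s))
    (C : Set X) (hC : IsSuslin C) (hCA : C ⊆ SuslinOp A)
    (hker : kerP P C = C) (hne : C.Nonempty) :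
    ∃ L : List ℕ → Set X, (∀ s, IsClosed (L s)) ∧ PRegular P L ∧ Subordinate L A ∧
      SuslinOp L ⊆ C ∧ C ⊆ closure (SuslinOp L) := by
  classical
  obtain ⟨B, hB, rfl⟩ := hC
  let D : List ℕ → Set X := fun s =>
    A (s.map fun k => (Nat.unpair k).1) ∩ B (s.map fun k => (Nat.unpair k).2)
  have hD : ∀ s, IsClosed (D s) := fun s => (hA _).inter (hB _)
  have hDC : Br D [] = SuslinOp B := by
    ext x
    constructor
    · rintro ⟨ν, -, h⟩
      refine mem_iUnion.2 ⟨fun k => (Nat.unpair (ν k)).2, mem_iInter.2 fun n => ?_⟩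
      have := (h n).2
      rwa [seg_map] at this
    · intro hx
      obtain ⟨α, hα⟩ := mem_iUnion.1 (hCA hx)
      obtain ⟨β, hβ⟩ := mem_iUnion.1 hx
      refine ⟨fun k => Nat.pair (α k) (β k), rfl, fun n => ⟨?_, ?_⟩⟩
      · rw [seg_map]; simpa using mem_iInter.1 hα n
      · rw [seg_map]; simpa using mem_iInter.1 hβ n
  let T : List ℕ → Prop := fun s => (kerP P (Br D s)).Nonempty
  have hT0 : T [] := by
    change (kerP P (Br D [])).Nonempty
    rw [hDC, hker]; exact hne
  have hTL : ∀ s, (LL P D s).Nonempty → T s := fun s h => closure_nonempty_iff.1 h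
  have hex : ∀ s n, ∃ m, (T s → T (s ++ [m])) ∧ (T (s ++ [n]) → m = n) := by
    intro s n
    by_cases h : T (s ++ [n])
    · exact ⟨n, fun _ => h, fun _ => rfl⟩
    · by_cases h' : T s
      · obtain ⟨m, hm⟩ := child_ne hP D s h'
        exact ⟨m, fun _ => hm, fun h2 => absurd h2 h⟩
      · exact ⟨n, fun h2 => absurd h2 h', fun _ => rfl⟩
  choose e he1 he2 using hex
  have hTpsi : ∀ s, T (psi e s) := by
    intro s
    induction s using List.reverseRecOn with
    | nil => exact hT0
    | append_singleton u n ih => rw [psi_snoc]; exact he1 _ _ ih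
  have hS : ∀ s, SuslinOp (fun t => LL P D (psi e (s ++ t))) = Br (LL P D) (psi e s) := by
    intro s
    rw [psi_suslin (LL P D) T hTL e he2, suslin_eq_Br _ (LL_mono hP D)]
  have hS0 : SuslinOp (fun t => LL P D (psi e t)) = Br (LL P D) [] := hS []
  refine ⟨fun s => LL P D (psi e s), fun s => isClosed_closure, ⟨?_, ?_⟩,
    ⟨fun s => (psi e s).map fun k => (Nat.unpair k).1, ?_, ?_, ?_⟩, ?_, ?_⟩
  · exact fun s t h => LL_mono hP D _ _ (psi_prefix e s t h)
  · intro s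
    rw [hS s]
    exact ⟨ker_BrL hP D _, closure_nonempty_iff.1 ((hTpsi s).mono (ker_dense hP D _))⟩
  · intro s; simp [psi_length]
  · exact fun s t h => (psi_prefix e s t h).map _
  · exact fun s => (LL_sub D hD _).trans inter_subset_left
  · rw [hS0, ← hDC]; exact BrL_sub D hD []
  · rw [hS0, ← hker, ← hDC]; exact ker_dense hP D []
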